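/- arXiv:2604.27562 — 11 statements merged into one kernel-verified Lean document; each statement's English description precedes it below -/
import Mathlib

section
/- Let W be a real symmetric n×n matrix with nonnegative entries, D the diagonal matrix with D_ii = Σ_j W_ij, and L = D − W. Let l ⊆ Fin n be the labeled set with complement u, and y : l → ℝ a label vector. If the submatrix L_uu (rows and columns of L restricted to u) is invertible, then the vector ℓ* defined by ℓ*_i = y_i for i ∈ l and ℓ*|_u = (L_uu)⁻¹ · W_ul · y is the unique minimizer of the quadratic form ℓᵀ L ℓ over all vectors ℓ : Fin n → ℝ satisfying ℓ_i = y_i for all i ∈ l. -/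
open Matrix

theorem laplacian_dotProduct_mulVec {ι : Type*} [Fintype ι] [DecidableEq ι]
    {W : Matrix ι ι ℝ} (hsymm : W.IsSymm) (x : ι → ℝ) :
    2 * (x ⬝ᵥ ((diagonal (fun i => ∑ j, W i j) - W) *ᵥ x)) =
      ∑ i, ∑ j, W i j * (x i - x j) ^ 2 := by
  have hswap : ∑ i, ∑ j, W i j * x j ^ 2 = ∑ i, ∑ j, W i j * x i ^ 2 := by
    rw [Finset.sum_comm]
    simp only [hsymm.apply]
  have hsq : ∑ i, ∑ j, W i j * (x i - x j) ^ 2 =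
      ∑ i, ∑ j, W i j * x i ^ 2 + ∑ i, ∑ j, W i j * x j ^ 2 -
        2 * ∑ i, ∑ j, x i * (W i j * x j) := by
    simp only [Finset.mul_sum, ← Finset.sum_add_distrib, ← Finset.sum_sub_distrib]
    refine Finset.sum_congr rfl fun i _ => Finset.sum_congr rfl fun j _ => ?_
    ring
  have hdiag : x ⬝ᵥ (diagonal (fun i => ∑ j, W i j) *ᵥ x) =
      ∑ i, ∑ j, W i j * x i ^ 2 := by
    simp only [dotProduct, mulVec_diagonal, Finset.sum_mul, Finset.mul_sum]
    refine Finset.sum_congr rfl fun i _ => Finset.sum_congr rfl fun j _ => ?_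
    ring
  have hoff : x ⬝ᵥ (W *ᵥ x) = ∑ i, ∑ j, x i * (W i j * x j) := by
    simp only [dotProduct, mulVec, Finset.mul_sum]
  rw [sub_mulVec, dotProduct_sub, hsq, hswap, hdiag, hoff]
  ring

theorem laplacian_posSemidef {ι : Type*} [Fintype ι] [DecidableEq ι]
    {W : Matrix ι ι ℝ} (hsymm : W.IsSymm) (hnn : ∀ i j, 0 ≤ W i j) :
    (diagonal (fun i => ∑ j, W i j) - W).PosSemidef := by
  refine PosSemidef.of_dotProduct_mulVec_nonneg ?_ fun x => ?_
  · rw [IsHermitian, conjTranspose_eq_transpose_of_trivial, transpose_sub,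
      diagonal_transpose, hsymm.eq]
  · have hsum : 0 ≤ ∑ i, ∑ j, W i j * (x i - x j) ^ 2 :=
      Finset.sum_nonneg fun i _ => Finset.sum_nonneg fun j _ =>
        mul_nonneg (hnn i j) (sq_nonneg _)
    rw [← laplacian_dotProduct_mulVec hsymm] at hsum
    rw [star_trivial]
    linarith

theorem mulVec_apply_eq_submatrix_add_submatrix {ι R : Type*} [Fintype ι] [DecidableEq ι]
    [NonUnitalNonAssocSemiring R] (A : Matrix ι ι R) (l : Finset ι) (x : ι → R)
    (i : {i // i ∈ lᶜ}) :
    (A *ᵥ x) i =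
      ((A.submatrix Subtype.val Subtype.val : Matrix {i // i ∈ lᶜ} {i // i ∈ l} R) *ᵥ
        fun j => x j) i +
      ((A.submatrix Subtype.val Subtype.val : Matrix {i // i ∈ lᶜ} {i // i ∈ lᶜ} R) *ᵥ
        fun j => x j) i := by
  simp only [mulVec, dotProduct, submatrix_apply]
  rw [Finset.sum_coe_sort l (fun j => A i j * x j),
    Finset.sum_coe_sort lᶜ (fun j => A i j * x j), Finset.sum_add_sum_compl]

/-- The harmonic function solution is the unique minimizer of the Laplacian
quadratic form subject to the label constraints. -/
theorem harmonic_function_solution_unique_minimizer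
    {n : ℕ} (W : Matrix (Fin n) (Fin n) ℝ)
    (hsymm : W.IsSymm) (hnn : ∀ i j, 0 ≤ W i j)
    (l : Finset (Fin n)) (y : {i // i ∈ l} → ℝ)
    (L : Matrix (Fin n) (Fin n) ℝ)
    (hL : L = Matrix.diagonal (fun i => ∑ j, W i j) - W)
    (Luu : Matrix {i // i ∈ lᶜ} {i // i ∈ lᶜ} ℝ)
    (hLuu : Luu = L.submatrix Subtype.val Subtype.val)
    (Wul : Matrix {i // i ∈ lᶜ} {i // i ∈ l} ℝ)
    (hWul : Wul = W.submatrix Subtype.val Subtype.val)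
    (hinv : IsUnit Luu)
    (ℓstar : Fin n → ℝ)
    (hstar : ∀ i : Fin n, ℓstar i =
      if h : i ∈ l then y ⟨i, h⟩
      else ((Luu⁻¹ * Wul) *ᵥ y) ⟨i, Finset.mem_compl.mpr h⟩) :
    (∀ i (h : i ∈ l), ℓstar i = y ⟨i, h⟩) ∧
    ∀ ℓ : Fin n → ℝ, (∀ i (h : i ∈ l), ℓ i = y ⟨i, h⟩) →
      ℓstar ⬝ᵥ (L *ᵥ ℓstar) ≤ ℓ ⬝ᵥ (L *ᵥ ℓ) ∧
      (ℓ ⬝ᵥ (L *ᵥ ℓ) = ℓstar ⬝ᵥ (L *ᵥ ℓstar) → ℓ = ℓstar) := by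
  have hpsd : L.PosSemidef := hL ▸ laplacian_posSemidef hsymm hnn
  have hLT : Lᵀ = L := by
    simpa only [IsHermitian, conjTranspose_eq_transpose_of_trivial] using hpsd.isHermitian
  have hlab : ∀ i (h : i ∈ l), ℓstar i = y ⟨i, h⟩ := fun i h => by rw [hstar, dif_pos h]
  have hLul : (L.submatrix Subtype.val Subtype.val :
      Matrix {i // i ∈ lᶜ} {i // i ∈ l} ℝ) = -Wul := by
    ext i j
    have hij : (i : Fin n) ≠ j := fun h => Finset.mem_compl.mp i.2 (h ▸ j.2)
    simp [hL, hWul, hij]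
  have hharm : ∀ i ∉ l, (L *ᵥ ℓstar) i = 0 := by
    intro i hi
    have hl : (fun j : {i // i ∈ l} => ℓstar j) = y := funext fun j => hlab j j.2
    have hu : (fun j : {i // i ∈ lᶜ} => ℓstar j) = (Luu⁻¹ * Wul) *ᵥ y := funext fun j => by
      rw [hstar, dif_neg (Finset.mem_compl.mp j.2)]
    have h := mulVec_apply_eq_submatrix_add_submatrix L l ℓstar ⟨i, Finset.mem_compl.mpr hi⟩
    rw [hl, hu, hLul, ← hLuu, mulVec_mulVec, ← Matrix.mul_assoc,
      mul_nonsing_inv _ ((isUnit_iff_isUnit_det _).mp hinv), Matrix.one_mul, neg_mulVec,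
      Pi.neg_apply, neg_add_cancel] at h
    exact h
  refine ⟨hlab, fun ℓ hℓ => ?_⟩
  obtain ⟨d, rfl⟩ : ∃ d, ℓ = ℓstar + d := ⟨ℓ - ℓstar, by abel⟩
  have hd : ∀ i ∈ l, d i = 0 := fun i hi => by
    simpa [hlab i hi] using hℓ i hi
  have hcross : d ⬝ᵥ (L *ᵥ ℓstar) = 0 := Finset.sum_eq_zero fun i _ => by
    by_cases hi : i ∈ l
    · rw [hd i hi, zero_mul]
    · rw [hharm i hi, mul_zero]
  have hcross' : ℓstar ⬝ᵥ (L *ᵥ d) = 0 := by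
    rw [dotProduct_mulVec, ← mulVec_transpose, hLT, dotProduct_comm, hcross]
  have hexp : (ℓstar + d) ⬝ᵥ (L *ᵥ (ℓstar + d)) =
      ℓstar ⬝ᵥ (L *ᵥ ℓstar) + d ⬝ᵥ (L *ᵥ d) := by
    rw [mulVec_add, add_dotProduct, dotProduct_add, dotProduct_add, hcross, hcross']
    ring
  have hnonneg : 0 ≤ d ⬝ᵥ (L *ᵥ d) := by
    simpa only [star_trivial] using hpsd.dotProduct_mulVec_nonneg d
  refine ⟨by linarith, fun heq => ?_⟩
  have hzero : L *ᵥ d = 0 :=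
    (hpsd.dotProduct_mulVec_zero_iff d).mp (by rw [star_trivial]; linarith)
  have hker : Luu *ᵥ (fun j => d j) = 0 := by
    ext i
    have hl : (fun j : {i // i ∈ l} => d j) = 0 := funext fun j => hd j j.2
    have h := mulVec_apply_eq_submatrix_add_submatrix L l d i
    rw [hzero, hl, mulVec_zero, ← hLuu, Pi.zero_apply, Pi.zero_apply, zero_add] at h
    exact h.symm
  have hdu : (fun j : {i // i ∈ lᶜ} => d j) = 0 :=
    mulVec_injective_of_isUnit hinv (by rw [hker, mulVec_zero])
  have hd0 : d = 0 := by
    ext i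
    by_cases hi : i ∈ l
    · exact hd i hi
    · exact congrFun hdu ⟨i, Finset.mem_compl.mpr hi⟩
  rw [hd0, add_zero]
end

section
/- Let W be a real symmetric n×n matrix with nonnegative entries, D the diagonal degree matrix, L = D − W, l ⊆ Fin n the labeled set with complement u, and y : l → ℝ. Suppose L_uu is invertible and let ℓ* be the vector with ℓ*_i = y_i for i ∈ l and ℓ*|_u = (L_uu)⁻¹ · W_ul · y. Then ℓ* satisfies the harmonic property: for every unlabeled vertex i ∈ u with degree d_i = Σ_j W_ij > 0, one has ℓ*_i = (1/d_i) · Σ_j W_ij · ℓ*_j. -/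
open Matrix

/-- The harmonic function solution satisfies the harmonic property: at every
unlabeled vertex of positive degree, its value is the degree-weighted average
of the values at the neighbors. -/
theorem harmonic_function_solution_harmonic_property
    {n : ℕ} (W : Matrix (Fin n) (Fin n) ℝ)
    (hsymm : W.IsSymm) (hnn : ∀ i j, 0 ≤ W i j)
    (l : Finset (Fin n)) (y : {i // i ∈ l} → ℝ)
    (L : Matrix (Fin n) (Fin n) ℝ)
    (hL : L = Matrix.diagonal (fun i => ∑ j, W i j) - W)
    (Luu : Matrix {i // i ∈ lᶜ} {i // i ∈ lᶜ} ℝ)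
    (hLuu : Luu = L.submatrix Subtype.val Subtype.val)
    (Wul : Matrix {i // i ∈ lᶜ} {i // i ∈ l} ℝ)
    (hWul : Wul = W.submatrix Subtype.val Subtype.val)
    (hinv : IsUnit Luu)
    (ℓstar : Fin n → ℝ)
    (hstar : ∀ i : Fin n, ℓstar i =
      if h : i ∈ l then y ⟨i, h⟩
      else ((Luu⁻¹ * Wul) *ᵥ y) ⟨i, Finset.mem_compl.mpr h⟩) :
    ∀ i : Fin n, i ∉ l → 0 < (∑ j, W i j) →
      ℓstar i = (1 / ∑ j, W i j) * ∑ j, W i j * ℓstar j := by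
  intro i hi hd
  have hl : ∀ j : {i // i ∈ l}, ℓstar j = y j := fun j => by
    rw [hstar, dif_pos j.2]
  have hu : (fun j : {i // i ∈ lᶜ} => ℓstar j) = (Luu⁻¹ * Wul) *ᵥ y := by
    funext j
    rw [hstar, dif_neg (Finset.mem_compl.mp j.2)]
  have hsys : Luu *ᵥ (fun j : {i // i ∈ lᶜ} => ℓstar j) = Wul *ᵥ y := by
    rw [hu, Matrix.mulVec_mulVec, Matrix.mul_nonsing_inv_cancel_left _ _
      ((Matrix.isUnit_iff_isUnit_det _).mp hinv)]
  have hrow := congrFun hsys ⟨i, Finset.mem_compl.mpr hi⟩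
  simp only [Matrix.mulVec, dotProduct, hLuu, hWul, hL, Matrix.submatrix_apply,
    Matrix.sub_apply, ← hl] at hrow
  rw [Finset.sum_coe_sort lᶜ (fun j => (Matrix.diagonal (fun i => ∑ j, W i j) i j - W i j)
      * ℓstar j), Finset.sum_coe_sort l (fun j => W i j * ℓstar j)] at hrow
  simp only [sub_mul, Finset.sum_sub_distrib, Matrix.diagonal_apply, ite_mul, zero_mul,
    Finset.sum_ite_eq, Finset.mem_compl, hi, not_false_eq_true, if_true] at hrow
  have hsplit := Finset.sum_add_sum_compl l (fun j => W i j * ℓstar j)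
  rw [one_div, eq_inv_mul_iff_mul_eq₀ hd.ne']
  linarith
end

section
/- Let W be a real symmetric n×n matrix with nonnegative entries whose row sums d_i = Σ_j W_ij are all strictly positive, D the diagonal degree matrix, L = D − W, and P = D⁻¹ · W. Let l ⊆ Fin n be the labeled set with complement u. If L_uu is invertible, then I − P_uu is invertible and (L_uu)⁻¹ · W_ul = (I − P_uu)⁻¹ · P_ul, i.e., the harmonic function solution coincides with the random-walk expression with transition matrix P. -/
open Matrix

/-- The harmonic function solution coincides with the random-walk expression
with transition matrix `P = D⁻¹ W`. -/
theorem harmonic_function_solution_random_walk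
    {n : ℕ} (W : Matrix (Fin n) (Fin n) ℝ)
    (hsymm : W.IsSymm) (hnn : ∀ i j, 0 ≤ W i j)
    (hd : ∀ i, 0 < ∑ j, W i j)
    (l : Finset (Fin n))
    (L : Matrix (Fin n) (Fin n) ℝ)
    (hL : L = Matrix.diagonal (fun i => ∑ j, W i j) - W)
    (P : Matrix (Fin n) (Fin n) ℝ)
    (hP : P = (Matrix.diagonal (fun i => ∑ j, W i j))⁻¹ * W)
    (Luu : Matrix {i // i ∈ lᶜ} {i // i ∈ lᶜ} ℝ)
    (hLuu : Luu = L.submatrix Subtype.val Subtype.val)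
    (Wul : Matrix {i // i ∈ lᶜ} {i // i ∈ l} ℝ)
    (hWul : Wul = W.submatrix Subtype.val Subtype.val)
    (Puu : Matrix {i // i ∈ lᶜ} {i // i ∈ lᶜ} ℝ)
    (hPuu : Puu = P.submatrix Subtype.val Subtype.val)
    (Pul : Matrix {i // i ∈ lᶜ} {i // i ∈ l} ℝ)
    (hPul : Pul = P.submatrix Subtype.val Subtype.val)
    (hinv : IsUnit Luu) :
    IsUnit (1 - Puu) ∧ Luu⁻¹ * Wul = (1 - Puu)⁻¹ * Pul := by
  have hdet {ι : Type} [Fintype ι] [DecidableEq ι] (f : ι → Fin n) :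
      IsUnit (diagonal fun i => ∑ j, W (f i) j).det := by
    rw [det_diagonal]
    exact (Finset.prod_pos fun i _ => hd (f i)).ne'.isUnit
  have hDP (i j : Fin n) : (∑ k, W i k) * P i j = W i j := by
    have h := mul_nonsing_inv_cancel_left _ W (hdet id)
    simp only [id, ← hP] at h
    simpa only [diagonal_mul] using congrFun₂ h i j
  have hE := hdet (Subtype.val : {i // i ∈ lᶜ} → Fin n)
  set E : Matrix {i // i ∈ lᶜ} {i // i ∈ lᶜ} ℝ := diagonal fun i => ∑ j, W i j with hEdef
  have hL' : Luu = E * (1 - Puu) := by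
    ext i j
    rw [hEdef, diagonal_mul, Matrix.sub_apply, mul_sub, hPuu, submatrix_apply, hDP, hLuu, hL,
      submatrix_apply, Matrix.sub_apply, diagonal_apply, one_apply]
    simp only [Subtype.ext_iff, mul_ite, mul_one, mul_zero]
  have hW' : Wul = E * Pul := by
    ext i j
    simp [hWul, hEdef, hPul, diagonal_mul, hDP]
  have hEunit : IsUnit E := (isUnit_iff_isUnit_det E).2 hE
  refine ⟨hEunit.mul_left_iff.1 (hL' ▸ hinv), ?_⟩
  rw [hL', hW', Matrix.mul_inv_rev, Matrix.mul_assoc, nonsing_inv_mul_cancel_left E Pul hE]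
end

section
/- Let W be a real symmetric n×n matrix with nonnegative entries, L its graph Laplacian, l ⊆ Fin n the labeled set with complement u, y : l → ℝ, and γ > 0 a real number. Then the vector ℓ* defined by ℓ*_i = y_i for i ∈ l and ℓ*|_u = (L_uu + γ·I)⁻¹ · W_ul · y is well defined (the inverse exists) and is the unique minimizer of the regularized quadratic form ℓᵀ (L + γ·I) ℓ over all vectors ℓ : Fin n → ℝ satisfying ℓ_i = y_i for all i ∈ l. -/
open Matrix

namespace Matrix

/-- The quadratic form of the graph Laplacian of a symmetric weight matrix. -/
theorem two_mul_dotProduct_laplacian_mulVec {ι : Type*} [Fintype ι] [DecidableEq ι]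
    {W : Matrix ι ι ℝ} (hW : W.IsSymm) (x : ι → ℝ) :
    2 * (x ⬝ᵥ ((diagonal (fun i => ∑ j, W i j) - W) *ᵥ x)) =
      ∑ i, ∑ j, W i j * (x i - x j) ^ 2 := by
  have h_diag : x ⬝ᵥ (diagonal (fun i => ∑ j, W i j) *ᵥ x) = ∑ i, ∑ j, W i j * x i ^ 2 := by
    simp only [dotProduct, mulVec_diagonal, Finset.sum_mul, Finset.mul_sum]
    exact Finset.sum_congr rfl fun i _ => Finset.sum_congr rfl fun j _ => by ring
  have h_swap : ∑ i, ∑ j, W i j * x j ^ 2 = ∑ i, ∑ j, W i j * x i ^ 2 := by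
    rw [Finset.sum_comm]
    exact Finset.sum_congr rfl fun i _ => Finset.sum_congr rfl fun j _ => by rw [hW.apply]
  have h_cross : x ⬝ᵥ (W *ᵥ x) = ∑ i, ∑ j, W i j * (x i * x j) := by
    simp only [dotProduct, mulVec, Finset.mul_sum]
    exact Finset.sum_congr rfl fun i _ => Finset.sum_congr rfl fun j _ => by ring
  have h_expand : ∑ i, ∑ j, W i j * (x i - x j) ^ 2 =
      ∑ i, ∑ j, W i j * x i ^ 2 + ∑ i, ∑ j, W i j * x j ^ 2
        - 2 * ∑ i, ∑ j, W i j * (x i * x j) := by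
    simp only [Finset.mul_sum, ← Finset.sum_add_distrib, ← Finset.sum_sub_distrib]
    exact Finset.sum_congr rfl fun i _ => Finset.sum_congr rfl fun j _ => by ring
  rw [sub_mulVec, dotProduct_sub, h_diag, h_cross, h_expand, h_swap]
  ring

theorem posSemidef_laplacian {ι : Type*} [Fintype ι] [DecidableEq ι]
    {W : Matrix ι ι ℝ} (hW : W.IsSymm) (hnn : ∀ i j, 0 ≤ W i j) :
    (diagonal (fun i => ∑ j, W i j) - W).PosSemidef := by
  refine .of_dotProduct_mulVec_nonneg ?_ fun x => ?_
  · rw [IsHermitian, conjTranspose_eq_transpose_of_trivial, transpose_sub,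
      diagonal_transpose, hW.eq]
  · rw [star_trivial]
    have h := two_mul_dotProduct_laplacian_mulVec hW x
    have h_nonneg : 0 ≤ ∑ i, ∑ j, W i j * (x i - x j) ^ 2 :=
      Finset.sum_nonneg fun i _ => Finset.sum_nonneg fun j _ =>
        mul_nonneg (hnn i j) (sq_nonneg _)
    linarith

/-- Expansion of a symmetric quadratic form around a point `x` at which the linear term
vanishes in the direction of the displacement. -/
theorem dotProduct_mulVec_eq_add_of_dotProduct_sub_eq_zero {ι : Type*} [Fintype ι]
    {A : Matrix ι ι ℝ} (hA : A.IsSymm) {x z : ι → ℝ} (h : (z - x) ⬝ᵥ (A *ᵥ x) = 0) :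
    z ⬝ᵥ (A *ᵥ z) = x ⬝ᵥ (A *ᵥ x) + (z - x) ⬝ᵥ (A *ᵥ (z - x)) := by
  have h_symm : x ⬝ᵥ (A *ᵥ (z - x)) = (z - x) ⬝ᵥ (A *ᵥ x) := by
    rw [dotProduct_mulVec, ← mulVec_transpose, hA.eq, dotProduct_comm]
  have hz : z = x + (z - x) := (add_sub_cancel x z).symm
  conv_lhs => rw [hz]
  rw [mulVec_add, dotProduct_add, add_dotProduct, add_dotProduct, h_symm, h]
  ring

end Matrix

/-- The regularized harmonic function solution is well defined and is the
unique minimizer of the regularized Laplacian quadratic form subject to the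
label constraints. -/
theorem regularized_harmonic_function_solution_unique_minimizer
    {n : ℕ} (W : Matrix (Fin n) (Fin n) ℝ)
    (hsymm : W.IsSymm) (hnn : ∀ i j, 0 ≤ W i j)
    (l : Finset (Fin n)) (y : {i // i ∈ l} → ℝ)
    (γ : ℝ) (hγ : 0 < γ)
    (L : Matrix (Fin n) (Fin n) ℝ)
    (hL : L = Matrix.diagonal (fun i => ∑ j, W i j) - W)
    (Luu : Matrix {i // i ∈ lᶜ} {i // i ∈ lᶜ} ℝ)
    (hLuu : Luu = L.submatrix Subtype.val Subtype.val)
    (Wul : Matrix {i // i ∈ lᶜ} {i // i ∈ l} ℝ)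
    (hWul : Wul = W.submatrix Subtype.val Subtype.val)
    (ℓstar : Fin n → ℝ)
    (hstar : ∀ i : Fin n, ℓstar i =
      if h : i ∈ l then y ⟨i, h⟩
      else (((Luu + γ • 1)⁻¹ * Wul) *ᵥ y) ⟨i, Finset.mem_compl.mpr h⟩) :
    IsUnit (Luu + γ • 1) ∧
    (∀ i (h : i ∈ l), ℓstar i = y ⟨i, h⟩) ∧
    ∀ ℓ : Fin n → ℝ, (∀ i (h : i ∈ l), ℓ i = y ⟨i, h⟩) →
      ℓstar ⬝ᵥ ((L + γ • 1) *ᵥ ℓstar) ≤ ℓ ⬝ᵥ ((L + γ • 1) *ᵥ ℓ) ∧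
      (ℓ ⬝ᵥ ((L + γ • 1) *ᵥ ℓ) = ℓstar ⬝ᵥ ((L + γ • 1) *ᵥ ℓstar) → ℓ = ℓstar) := by
  have h_pos : (L + γ • (1 : Matrix (Fin n) (Fin n) ℝ)).PosDef := by
    rw [hL]
    exact (PosDef.one.smul hγ).posSemidef_add (posSemidef_laplacian hsymm hnn)
  have h_symm : (L + γ • (1 : Matrix (Fin n) (Fin n) ℝ)).IsSymm := by
    rw [IsSymm, ← conjTranspose_eq_transpose_of_trivial]
    exact h_pos.isHermitian
  have h_sub : Luu + γ • 1 =
      (L + γ • (1 : Matrix (Fin n) (Fin n) ℝ)).submatrix Subtype.val Subtype.val := by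
    rw [hLuu, submatrix_add, submatrix_smul]
    exact congrArg (L.submatrix _ _ + γ • ·) (submatrix_one _ Subtype.val_injective).symm
  have h_unit : IsUnit (Luu + γ • 1) := by
    rw [h_sub]
    exact (h_pos.submatrix Subtype.val_injective).isUnit
  have h_label : ∀ i (h : i ∈ l), ℓstar i = y ⟨i, h⟩ := fun i h => by
    rw [hstar, dif_pos h]
  have h_restrict : (fun j : {i // i ∈ lᶜ} => ℓstar j) = (Luu + γ • 1)⁻¹ *ᵥ (Wul *ᵥ y) := by
    ext j
    rw [hstar, dif_neg (Finset.mem_compl.mp j.2), mulVec_mulVec]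
  have h_harmonic : ∀ i, i ∉ l → ((L + γ • (1 : Matrix (Fin n) (Fin n) ℝ)) *ᵥ ℓstar) i = 0 := by
    intro i hi
    have h_solve : (Luu + γ • 1) *ᵥ (fun j : {i // i ∈ lᶜ} => ℓstar j) = Wul *ᵥ y := by
      rw [h_restrict, mulVec_mulVec,
        mul_nonsing_inv _ ((isUnit_iff_isUnit_det _).mp h_unit), one_mulVec]
    have h_row := congrFun h_solve ⟨i, Finset.mem_compl.mpr hi⟩
    rw [h_sub] at h_row
    simp only [mulVec, dotProduct, submatrix_apply, hWul] at h_row ⊢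
    rw [← Finset.sum_add_sum_compl l, ← Finset.sum_coe_sort l, ← Finset.sum_coe_sort lᶜ,
      h_row, ← Finset.sum_add_distrib]
    refine Finset.sum_eq_zero fun j _ => ?_
    have hij : i ≠ j := fun h => hi (h ▸ j.2)
    simp [hL, hij, h_label j j.2]
  refine ⟨h_unit, h_label, fun ℓ hℓ => ?_⟩
  have h_orth : (ℓ - ℓstar) ⬝ᵥ ((L + γ • (1 : Matrix (Fin n) (Fin n) ℝ)) *ᵥ ℓstar) = 0 := by
    refine Finset.sum_eq_zero fun i _ => ?_
    by_cases hi : i ∈ l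
    · rw [Pi.sub_apply, hℓ i hi, h_label i hi, sub_self, zero_mul]
    · rw [h_harmonic i hi, mul_zero]
  rw [dotProduct_mulVec_eq_add_of_dotProduct_sub_eq_zero h_symm h_orth]
  refine ⟨le_add_of_nonneg_right ?_, fun h_eq => ?_⟩
  · simpa using h_pos.posSemidef.dotProduct_mulVec_nonneg (ℓ - ℓstar)
  · by_contra h_ne
    have h_gt := h_pos.dotProduct_mulVec_pos (sub_ne_zero.mpr h_ne)
    rw [star_trivial] at h_gt
    linarith
end

section
/- Let W be a real symmetric n×n matrix with nonnegative entries, D the diagonal degree matrix, L = D − W, l ⊆ Fin n the labeled set with complement u, and γ > 0. Define Q = (D + γ·I)⁻¹ · W. Then I − Q_uu is invertible and (L_uu + γ·I)⁻¹ · W_ul = (I − Q_uu)⁻¹ · Q_ul. (This identity expresses the regularized harmonic function solution as a random walk with an extra sink: at each step the walk at vertex i terminates at the sink with probability γ/(d_i + γ).) -/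
open Matrix

/-- A principal submatrix of the graph Laplacian shifted by a positive multiple of the identity
is strictly diagonally dominant, hence nonsingular. -/
theorem det_laplacian_submatrix_add_smul_one_ne_zero {ι : Type*} [Fintype ι] [DecidableEq ι]
    (W : Matrix ι ι ℝ) (hnn : ∀ i j, 0 ≤ W i j) (u : Finset ι) (γ : ℝ) (hγ : 0 < γ) :
    ((diagonal (fun i => ∑ j, W i j) - W).submatrix
      (Subtype.val : {i // i ∈ u} → ι) (Subtype.val : {i // i ∈ u} → ι) + γ • 1).det ≠ 0 := by
  apply det_ne_zero_of_sum_row_lt_diag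
  intro i
  have hoff : ∑ j ∈ Finset.univ.erase i,
      ‖((diagonal (fun i => ∑ j, W i j) - W).submatrix
        (Subtype.val : {i // i ∈ u} → ι) (Subtype.val : {i // i ∈ u} → ι) + γ • 1) i j‖
      = ∑ j ∈ Finset.univ.erase i, W i j := by
    refine Finset.sum_congr rfl fun j hj => ?_
    have hij : i ≠ j := (Finset.ne_of_mem_erase hj).symm
    have hij' : (i : ι) ≠ j := fun h => hij (Subtype.ext h)
    simp [hij, hij', abs_of_nonneg (hnn i j)]
  have hle : W i i + ∑ j ∈ Finset.univ.erase i, W i j ≤ ∑ j, W i j := by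
    rw [Finset.add_sum_erase _ (fun j : {i // i ∈ u} => W i j) (Finset.mem_univ i),
      Finset.sum_coe_sort u (fun j => W i j)]
    exact Finset.sum_le_sum_of_subset_of_nonneg (Finset.subset_univ u) fun j _ _ => hnn i j
  rw [hoff]
  refine lt_of_lt_of_le ?_ (le_abs_self _)
  simp only [Matrix.add_apply, submatrix_apply, Matrix.sub_apply, diagonal_apply_eq, Matrix.smul_apply, one_apply_eq,
    smul_eq_mul, mul_one]
  linarith

/-- The regularized harmonic function solution coincides with the random-walk
expression for the walk with an extra sink, whose transition matrix is
`Q = (D + γ I)⁻¹ W`. -/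
theorem regularized_harmonic_function_solution_random_walk_with_sink
    {n : ℕ} (W : Matrix (Fin n) (Fin n) ℝ)
    (hsymm : W.IsSymm) (hnn : ∀ i j, 0 ≤ W i j)
    (l : Finset (Fin n)) (γ : ℝ) (hγ : 0 < γ)
    (L : Matrix (Fin n) (Fin n) ℝ)
    (hL : L = Matrix.diagonal (fun i => ∑ j, W i j) - W)
    (Q : Matrix (Fin n) (Fin n) ℝ)
    (hQ : Q = (Matrix.diagonal (fun i => ∑ j, W i j) + γ • 1)⁻¹ * W)
    (Luu : Matrix {i // i ∈ lᶜ} {i // i ∈ lᶜ} ℝ)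
    (hLuu : Luu = L.submatrix Subtype.val Subtype.val)
    (Wul : Matrix {i // i ∈ lᶜ} {i // i ∈ l} ℝ)
    (hWul : Wul = W.submatrix Subtype.val Subtype.val)
    (Quu : Matrix {i // i ∈ lᶜ} {i // i ∈ lᶜ} ℝ)
    (hQuu : Quu = Q.submatrix Subtype.val Subtype.val)
    (Qul : Matrix {i // i ∈ lᶜ} {i // i ∈ l} ℝ)
    (hQul : Qul = Q.submatrix Subtype.val Subtype.val) :
    IsUnit (1 - Quu) ∧ (Luu + γ • 1)⁻¹ * Wul = (1 - Quu)⁻¹ * Qul := by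
  subst hL hLuu hWul hQuu hQul
  have hpos : ∀ i, 0 < (∑ j, W i j) + γ := fun i =>
    add_pos_of_nonneg_of_pos (Finset.sum_nonneg fun j _ => hnn i j) hγ
  have hW : ∀ i j, W i j = ((∑ k, W i k) + γ) * Q i j := by
    have hdiag : diagonal (fun i => ∑ j, W i j) + γ • (1 : Matrix (Fin n) (Fin n) ℝ)
        = diagonal fun i => (∑ j, W i j) + γ := by
      rw [smul_one_eq_diagonal, diagonal_add]
    have hunit : IsUnit (diagonal fun i => (∑ j, W i j) + γ).det := by
      rw [det_diagonal]
      exact (Finset.prod_pos fun i _ => hpos i).ne'.isUnit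
    intro i j
    rw [hQ, hdiag, ← diagonal_mul (fun i => (∑ k, W i k) + γ), mul_nonsing_inv_cancel_left _ _ hunit]
  set E : Matrix {i // i ∈ lᶜ} {i // i ∈ lᶜ} ℝ :=
    diagonal fun i => (∑ j, W i j) + γ with hE
  have hEdet : IsUnit E.det := by
    rw [hE, det_diagonal]
    exact (Finset.prod_pos fun i _ => hpos i.val).ne'.isUnit
  have hWul : W.submatrix (Subtype.val : {i // i ∈ lᶜ} → Fin n) (Subtype.val : {i // i ∈ l} → Fin n)
      = E * Q.submatrix (Subtype.val : {i // i ∈ lᶜ} → Fin n)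
        (Subtype.val : {i // i ∈ l} → Fin n) := by
    ext i j
    rw [hE, diagonal_mul]
    exact hW i j
  have hLuu : (diagonal (fun i => ∑ j, W i j) - W).submatrix
        (Subtype.val : {i // i ∈ lᶜ} → Fin n) (Subtype.val : {i // i ∈ lᶜ} → Fin n) + γ • 1
      = E * (1 - Q.submatrix (Subtype.val : {i // i ∈ lᶜ} → Fin n)
        (Subtype.val : {i // i ∈ lᶜ} → Fin n)) := by
    ext i j
    rw [hE, diagonal_mul]
    by_cases hij : i = j
    · subst hij
      simp only [Matrix.add_apply, submatrix_apply, Matrix.sub_apply, diagonal_apply_eq, Matrix.smul_apply,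
        one_apply_eq, smul_eq_mul]
      linarith [hW i i]
    · have hij' : (i : Fin n) ≠ j := fun h => hij (Subtype.ext h)
      simp only [Matrix.add_apply, submatrix_apply, Matrix.sub_apply, diagonal_apply_ne _ hij', Matrix.smul_apply,
        one_apply_ne hij, smul_eq_mul]
      linarith [hW i j]
  have hdet := det_laplacian_submatrix_add_smul_one_ne_zero W hnn lᶜ γ hγ
  rw [hLuu, det_mul] at hdet
  refine ⟨(isUnit_iff_isUnit_det _).2 (right_ne_zero_of_mul hdet).isUnit, ?_⟩
  rw [hLuu, hWul, Matrix.mul_inv_rev, Matrix.mul_assoc, nonsing_inv_mul_cancel_left _ _ hEdet]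
end

section
/- Let W be a real symmetric n×n matrix with nonnegative entries, L its graph Laplacian, l ⊆ Fin n the labeled set with complement u, and y : l → ℝ. Then the regularized harmonic function solution on the unlabeled vertices tends to zero as the regularization grows: the vector-valued function γ ↦ (L_uu + γ·I)⁻¹ · W_ul · y tends to the zero vector as γ → ∞. (The confidence of labeling unlabeled vertices decreases to zero as γ → ∞.) -/
open Matrix Filter

/-- The resolvent of a square real matrix vanishes at infinity. -/
theorem Matrix.tendsto_inv_add_smul_one_atTop {m : Type*} [Fintype m] [DecidableEq m]
    (A : Matrix m m ℝ) :
    Tendsto (fun γ : ℝ => (A + γ • (1 : Matrix m m ℝ))⁻¹) atTop (nhds 0) := by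
  have hB : Tendsto (fun γ : ℝ => γ⁻¹ • A + 1) atTop (nhds 1) := by
    simpa using ((tendsto_inv_atTop_zero (𝕜 := ℝ)).smul_const A).add_const (1 : Matrix m m ℝ)
  have hdet : Tendsto (fun γ : ℝ => (γ⁻¹ • A + 1).det) atTop (nhds 1) := by
    simpa [Function.comp_def] using ((continuous_id.matrix_det).tendsto (1 : Matrix m m ℝ)).comp hB
  have hinv : ContinuousAt Inv.inv (1 : Matrix m m ℝ) := by
    refine continuousAt_matrix_inv _ ?_
    simpa only [det_one, Ring.inverse_eq_inv'] using continuousAt_inv₀ (one_ne_zero (α := ℝ))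
  have hlim : Tendsto (fun γ : ℝ => γ⁻¹ • (γ⁻¹ • A + 1)⁻¹) atTop (nhds 0) := by
    simpa [Function.comp_def] using (tendsto_inv_atTop_zero (𝕜 := ℝ)).smul (hinv.tendsto.comp hB)
  refine hlim.congr' ?_
  filter_upwards [eventually_ne_atTop 0, hdet.eventually_ne one_ne_zero] with γ hγ hd
  have hfactor : A + γ • 1 = γ • (γ⁻¹ • A + 1) := by
    rw [smul_add, smul_inv_smul₀ hγ]
  rw [hfactor]
  exact (inv_smul' _ (Units.mk0 γ hγ) hd.isUnit).symm

/-- The regularized harmonic function solution on the unlabeled vertices tends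
to the zero vector as the regularization parameter γ tends to infinity. -/
theorem regularized_harmonic_function_solution_tendsto_zero
    {n : ℕ} (W : Matrix (Fin n) (Fin n) ℝ)
    (hsymm : W.IsSymm) (hnn : ∀ i j, 0 ≤ W i j)
    (l : Finset (Fin n)) (y : {i // i ∈ l} → ℝ)
    (L : Matrix (Fin n) (Fin n) ℝ)
    (hL : L = Matrix.diagonal (fun i => ∑ j, W i j) - W)
    (Luu : Matrix {i // i ∈ lᶜ} {i // i ∈ lᶜ} ℝ)
    (hLuu : Luu = L.submatrix Subtype.val Subtype.val)
    (Wul : Matrix {i // i ∈ lᶜ} {i // i ∈ l} ℝ)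
    (hWul : Wul = W.submatrix Subtype.val Subtype.val) :
    Tendsto (fun γ : ℝ => ((Luu + γ • 1)⁻¹ * Wul) *ᵥ y) atTop (nhds 0) := by
  have h := Matrix.tendsto_inv_add_smul_one_atTop Luu
  have hc : Continuous fun M : Matrix {i // i ∈ lᶜ} {i // i ∈ lᶜ} ℝ => (M * Wul) *ᵥ y := by
    fun_prop
  simpa [Function.comp_def] using (hc.tendsto 0).comp h
end

section
/- Let P be a real n×n row-stochastic matrix (nonnegative entries, each row summing to 1) with index set partitioned into a labeled set l and unlabeled set u. Suppose I − P_uu is invertible and all entries of (I − P_uu)⁻¹ are nonnegative. Then for any label vector y : l → ℝ with y_j ∈ [−1, 1] for all j ∈ l, every entry of the harmonic function solution ℓ_u = (I − P_uu)⁻¹ · P_ul · y lies in [−1, 1]; i.e., the confidence |ℓ_i| of each predicted label is at most 1. -/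
open Matrix

/-- A matrix with nonnegative entries and unit row sums maps vectors with entries in `[a, b]` to
vectors with entries in `[a, b]`. -/
theorem mulVec_mem_Icc_of_rowSum_eq_one {m k : Type*} [Fintype k] {M : Matrix m k ℝ}
    (hM : ∀ i j, 0 ≤ M i j) (hsum : M *ᵥ 1 = 1) {a b : ℝ} {y : k → ℝ}
    (hy : ∀ j, y j ∈ Set.Icc a b) (i : m) : (M *ᵥ y) i ∈ Set.Icc a b := by
  have h1 : ∑ j, M i j = 1 := by simpa [mulVec, dotProduct] using congrFun hsum i
  exact (convex_Icc a b).sum_mem (fun j _ => hM i j) h1 (fun j _ => hy j)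

/-- If the labels lie in `[-1, 1]`, every entry of the harmonic function
solution `(I - P_uu)⁻¹ P_ul y` lies in `[-1, 1]`: the confidence of each
predicted label is at most 1. -/
theorem harmonic_solution_confidence_le_one
    {n : ℕ} (P : Matrix (Fin n) (Fin n) ℝ)
    (hnn : ∀ i j, 0 ≤ P i j) (hrow : ∀ i, ∑ j, P i j = 1)
    (l : Finset (Fin n))
    (Puu : Matrix {i // i ∈ lᶜ} {i // i ∈ lᶜ} ℝ)
    (hPuu : Puu = P.submatrix Subtype.val Subtype.val)
    (Pul : Matrix {i // i ∈ lᶜ} {i // i ∈ l} ℝ)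
    (hPul : Pul = P.submatrix Subtype.val Subtype.val)
    (hinv : IsUnit (1 - Puu))
    (hinvnn : ∀ i j, 0 ≤ (1 - Puu)⁻¹ i j)
    (y : {i // i ∈ l} → ℝ) (hy : ∀ j, y j ∈ Set.Icc (-1 : ℝ) 1) :
    ∀ i, (((1 - Puu)⁻¹ * Pul) *ᵥ y) i ∈ Set.Icc (-1 : ℝ) 1 := by
  have hone : Pul *ᵥ 1 = (1 - Puu) *ᵥ 1 := by
    ext i
    have hsplit := Finset.sum_add_sum_compl l (P i)
    rw [hrow, ← Finset.sum_coe_sort l, ← Finset.sum_coe_sort lᶜ] at hsplit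
    rw [sub_mulVec, one_mulVec]
    simp only [Pi.sub_apply, Pi.one_apply, mulVec, dotProduct, mul_one, hPuu, hPul,
      submatrix_apply]
    linarith
  refine mulVec_mem_Icc_of_rowSum_eq_one (fun i j => ?_) ?_ hy
  · exact Finset.sum_nonneg fun k _ => mul_nonneg (hinvnn i k) (by simp [hPul, hnn])
  · rw [← mulVec_mulVec, hone, mulVec_mulVec,
      nonsing_inv_mul _ ((isUnit_iff_isUnit_det _).mp hinv), one_mulVec]
end

section
/- (Quadratic-form identity underlying Proposition 1.) Let W be a real symmetric m×m matrix with nonnegative entries, v : Fin m → ℕ a vector of positive multiplicities, n = Σ_i v_i, and π : Fin n → Fin m a surjection such that each fiber π⁻¹(i) has exactly v_i elements. Let W̃ be the expanded n×n matrix with W̃_{ab} = W_{π(a)π(b)}, L̃ its graph Laplacian, V the m×m diagonal matrix with V_ii = v_i, Ŵ = V·W·V, and L̂ the graph Laplacian of Ŵ. Then for every γ ≥ 0 and every ℓ : Fin m → ℝ, the pullback ℓ̃ = ℓ ∘ π satisfies ℓ̃ᵀ (L̃ + γ·I) ℓ̃ = ℓᵀ (L̂ + γ·V) ℓ. -/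
open Matrix

theorem Finset.sum_comp_eq_sum_card_fiber_mul {α ι R : Type*} [Fintype α] [Fintype ι]
    [DecidableEq ι] [NonAssocSemiring R] {π : α → ι} {v : ι → ℕ}
    (hfib : ∀ i, (Finset.univ.filter fun a => π a = i).card = v i) (f : ι → R) :
    ∑ a, f (π a) = ∑ i, (v i : R) * f i := by
  rw [← Finset.sum_fiberwise' Finset.univ π f]
  simp [hfib]

theorem Matrix.dotProduct_laplacian_mulVec {α R : Type*} [Fintype α] [DecidableEq α] [CommRing R]
    (M : Matrix α α R) (x : α → R) :
    x ⬝ᵥ ((diagonal (fun a => ∑ b, M a b) - M) *ᵥ x) =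
      ∑ a, ∑ b, M a b * (x a * x a - x a * x b) := by
  simp only [sub_mulVec, dotProduct, Pi.sub_apply, mulVec_diagonal]
  refine Finset.sum_congr rfl fun a _ => ?_
  simp only [mulVec, dotProduct, mul_sub, Finset.mul_sum, Finset.sum_mul,
    Finset.sum_sub_distrib]
  congr 1 <;> exact Finset.sum_congr rfl fun b _ => by ring

/-- Quadratic-form identity underlying Proposition 1: the regularized
Laplacian quadratic form of the expanded graph, evaluated at the pullback of a
vector `ℓ`, equals the compact quadratic form `ℓᵀ (L̂ + γ V) ℓ`. -/
theorem quantized_quadratic_form_identity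
    {m n : ℕ} (W : Matrix (Fin m) (Fin m) ℝ)
    (hsymm : W.IsSymm) (hnn : ∀ i j, 0 ≤ W i j)
    (v : Fin m → ℕ) (hv : ∀ i, 0 < v i)
    (hn : n = ∑ i, v i)
    (π : Fin n → Fin m) (hπ : Function.Surjective π)
    (hfib : ∀ i, (Finset.univ.filter fun a => π a = i).card = v i)
    (Wt : Matrix (Fin n) (Fin n) ℝ)
    (hWt : ∀ a b, Wt a b = W (π a) (π b))
    (Lt : Matrix (Fin n) (Fin n) ℝ)
    (hLt : Lt = Matrix.diagonal (fun a => ∑ b, Wt a b) - Wt)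
    (V : Matrix (Fin m) (Fin m) ℝ)
    (hV : V = Matrix.diagonal fun i => (v i : ℝ))
    (What : Matrix (Fin m) (Fin m) ℝ) (hWhat : What = V * W * V)
    (Lhat : Matrix (Fin m) (Fin m) ℝ)
    (hLhat : Lhat = Matrix.diagonal (fun i => ∑ j, What i j) - What)
    (γ : ℝ) (hγ : 0 ≤ γ) (ℓ : Fin m → ℝ) :
    (ℓ ∘ π) ⬝ᵥ ((Lt + γ • 1) *ᵥ (ℓ ∘ π)) = ℓ ⬝ᵥ ((Lhat + γ • V) *ᵥ ℓ) := by
  subst hLt hV hWhat hLhat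
  simp only [add_mulVec, dotProduct_add, dotProduct_laplacian_mulVec, smul_mulVec, dotProduct_smul,
    one_mulVec]
  congr 1
  · simp only [hWt, Function.comp_apply]
    rw [Finset.sum_comp_eq_sum_card_fiber_mul hfib fun i =>
      ∑ b, W i (π b) * (ℓ i * ℓ i - ℓ i * ℓ (π b))]
    refine Finset.sum_congr rfl fun i _ => ?_
    rw [Finset.sum_comp_eq_sum_card_fiber_mul hfib fun j => W i j * (ℓ i * ℓ i - ℓ i * ℓ j),
      Finset.mul_sum]
    refine Finset.sum_congr rfl fun j _ => ?_
    rw [mul_diagonal, diagonal_mul]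
    ring
  · congr 1
    simp only [dotProduct, Function.comp_apply, mulVec_diagonal]
    rw [Finset.sum_comp_eq_sum_card_fiber_mul hfib fun i => ℓ i * ℓ i]
    exact Finset.sum_congr rfl fun i _ => by ring
end

section
/- (Proposition 1, constancy on merged vertices.) Let W be a real symmetric m×m matrix with nonnegative entries, v : Fin m → ℕ positive multiplicities with v_i = 1 for every labeled vertex i, n = Σ_i v_i, and π : Fin n → Fin m a surjection with fibers of size v_i. Let W̃ be the expanded n×n matrix with W̃_{ab} = W_{π(a)π(b)} and L̃ its graph Laplacian. Fix γ > 0, a labeled set l ⊆ Fin m, and labels y : l → ℝ. Then the unique minimizer ℓ̃* of ℓ̃ᵀ (L̃ + γ·I) ℓ̃ over vectors ℓ̃ : Fin n → ℝ satisfying ℓ̃_a = y_{π(a)} whenever π(a) ∈ l, is constant on each fiber of π: π(a) = π(b) implies ℓ̃*_a = ℓ̃*_b. -/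
open Matrix

section LaplacianQuadraticForm

variable {ι : Type*} [Fintype ι] [DecidableEq ι]

/-- The regularized Laplacian quadratic form as a weighted sum of squared differences. -/
theorem dotProduct_laplacian_add_smul_one_mulVec {M : Matrix ι ι ℝ} (hM : M.IsSymm)
    (γ : ℝ) (x : ι → ℝ) :
    x ⬝ᵥ ((diagonal (fun a => ∑ b, M a b) - M + γ • 1) *ᵥ x) =
      (∑ a, ∑ b, M a b * (x a - x b) ^ 2) / 2 + γ * ∑ a, x a ^ 2 := by
  have hswap : ∑ a, ∑ b, M a b * x b ^ 2 = ∑ a, ∑ b, M a b * x a ^ 2 := by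
    rw [Finset.sum_comm]
    simp_rw [hM.apply]
  have hexpand : ∑ a, ∑ b, M a b * (x a - x b) ^ 2 =
      ∑ a, ∑ b, M a b * x a ^ 2 + ∑ a, ∑ b, M a b * x b ^ 2
        - 2 * ∑ a, ∑ b, x a * (M a b * x b) := by
    simp only [Finset.mul_sum, ← Finset.sum_add_distrib, ← Finset.sum_sub_distrib]
    exact Finset.sum_congr rfl fun a _ => Finset.sum_congr rfl fun b _ => by ring
  have hdiag : x ⬝ᵥ (diagonal (fun a => ∑ b, M a b) *ᵥ x) = ∑ a, ∑ b, M a b * x a ^ 2 := by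
    simp only [dotProduct, mulVec_diagonal, ← Finset.sum_mul]
    exact Finset.sum_congr rfl fun a _ => by ring
  have hoff : x ⬝ᵥ (M *ᵥ x) = ∑ a, ∑ b, x a * (M a b * x b) := by
    simp only [dotProduct, mulVec, Finset.mul_sum]
  have hone : x ⬝ᵥ x = ∑ a, x a ^ 2 := by
    simp only [dotProduct, sq]
  rw [add_mulVec, sub_mulVec, smul_mulVec, one_mulVec, dotProduct_add, dotProduct_sub,
    dotProduct_smul, smul_eq_mul, hdiag, hoff, hone, hexpand, hswap]
  ring

/-- The regularized Laplacian quadratic form is invariant under automorphisms of the graph. -/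
theorem dotProduct_laplacian_add_smul_one_mulVec_comp_equiv {M : Matrix ι ι ℝ} (hM : M.IsSymm)
    (γ : ℝ) (σ : Equiv.Perm ι) (hσ : ∀ a b, M (σ a) (σ b) = M a b) (x : ι → ℝ) :
    (x ∘ σ) ⬝ᵥ ((diagonal (fun a => ∑ b, M a b) - M + γ • 1) *ᵥ (x ∘ σ)) =
      x ⬝ᵥ ((diagonal (fun a => ∑ b, M a b) - M + γ • 1) *ᵥ x) := by
  rw [dotProduct_laplacian_add_smul_one_mulVec hM, dotProduct_laplacian_add_smul_one_mulVec hM,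
    ← Equiv.sum_comp σ fun a => x a ^ 2,
    ← Equiv.sum_comp σ fun a => ∑ b, M a b * (x a - x b) ^ 2]
  congr 2
  refine Finset.sum_congr rfl fun a _ => ?_
  rw [← Equiv.sum_comp σ fun b => M (σ a) b * (x (σ a) - x b) ^ 2]
  simp only [hσ, Function.comp_apply]

/-- The regularized Laplacian quadratic form is positive definite. -/
theorem eq_zero_of_dotProduct_laplacian_add_smul_one_mulVec_nonpos {M : Matrix ι ι ℝ}
    (hM : M.IsSymm) (hnn : ∀ a b, 0 ≤ M a b) {γ : ℝ} (hγ : 0 < γ) {x : ι → ℝ}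
    (hx : x ⬝ᵥ ((diagonal (fun a => ∑ b, M a b) - M + γ • 1) *ᵥ x) ≤ 0) : x = 0 := by
  rw [dotProduct_laplacian_add_smul_one_mulVec hM] at hx
  have hlap : 0 ≤ ∑ a, ∑ b, M a b * (x a - x b) ^ 2 :=
    Finset.sum_nonneg fun a _ => Finset.sum_nonneg fun b _ => mul_nonneg (hnn a b) (sq_nonneg _)
  have hsq : ∑ a, x a ^ 2 ≤ 0 := nonpos_of_mul_nonpos_right (by linarith) hγ
  funext a
  have ha : x a ^ 2 ≤ ∑ a, x a ^ 2 :=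
    Finset.single_le_sum (f := fun a => x a ^ 2) (fun b _ => sq_nonneg (x b)) (Finset.mem_univ a)
  exact pow_eq_zero_iff two_ne_zero |>.1 (le_antisymm (ha.trans hsq) (sq_nonneg _))

end LaplacianQuadraticForm

/-- The parallelogram law for the quadratic form of a matrix, at the midpoint. -/
theorem dotProduct_mulVec_midpoint {ι : Type*} [Fintype ι] (A : Matrix ι ι ℝ) (x z : ι → ℝ) :
    ((1 / 2 : ℝ) • (x + z)) ⬝ᵥ (A *ᵥ ((1 / 2 : ℝ) • (x + z))) =
      (x ⬝ᵥ (A *ᵥ x) + z ⬝ᵥ (A *ᵥ z)) / 2 -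
        ((1 / 2 : ℝ) • (x - z)) ⬝ᵥ (A *ᵥ ((1 / 2 : ℝ) • (x - z))) := by
  simp only [mulVec_smul, mulVec_add, mulVec_sub, dotProduct_smul, smul_dotProduct,
    dotProduct_add, add_dotProduct, dotProduct_sub, sub_dotProduct, smul_eq_mul]
  ring

/-- Proposition 1, constancy on merged vertices: the minimizer of the
regularized Laplacian quadratic form on the expanded graph, subject to the
label constraints, is constant on each fiber of the quantization map `π`. -/
theorem quantized_minimizer_constant_on_fibers
    {m n : ℕ} (W : Matrix (Fin m) (Fin m) ℝ)
    (hsymm : W.IsSymm) (hnn : ∀ i j, 0 ≤ W i j)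
    (l : Finset (Fin m)) (y : {i // i ∈ l} → ℝ)
    (v : Fin m → ℕ) (hv : ∀ i, 0 < v i) (hvl : ∀ i ∈ l, v i = 1)
    (hn : n = ∑ i, v i)
    (π : Fin n → Fin m) (hπ : Function.Surjective π)
    (hfib : ∀ i, (Finset.univ.filter fun a => π a = i).card = v i)
    (Wt : Matrix (Fin n) (Fin n) ℝ)
    (hWt : ∀ a b, Wt a b = W (π a) (π b))
    (Lt : Matrix (Fin n) (Fin n) ℝ)
    (hLt : Lt = Matrix.diagonal (fun a => ∑ b, Wt a b) - Wt)
    (γ : ℝ) (hγ : 0 < γ)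
    (ℓt : Fin n → ℝ)
    (hfeas : ∀ a (h : π a ∈ l), ℓt a = y ⟨π a, h⟩)
    (hmin : ∀ ℓ' : Fin n → ℝ, (∀ a (h : π a ∈ l), ℓ' a = y ⟨π a, h⟩) →
      ℓt ⬝ᵥ ((Lt + γ • 1) *ᵥ ℓt) ≤ ℓ' ⬝ᵥ ((Lt + γ • 1) *ᵥ ℓ')) :
    ∀ a b, π a = π b → ℓt a = ℓt b := by
  subst hLt
  intro a b hab
  have hM : Wt.IsSymm := Matrix.IsSymm.ext fun c d => by rw [hWt, hWt, hsymm.apply]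
  have hMnn : ∀ c d, 0 ≤ Wt c d := fun c d => by rw [hWt]; exact hnn _ _
  have hπσ : ∀ c, π (Equiv.swap a b c) = π c := by
    intro c
    rcases eq_or_ne c a with rfl | hca
    · rw [Equiv.swap_apply_left, hab]
    rcases eq_or_ne c b with rfl | hcb
    · rw [Equiv.swap_apply_right, hab]
    rw [Equiv.swap_apply_of_ne_of_ne hca hcb]
  have hσ : ∀ c d, Wt (Equiv.swap a b c) (Equiv.swap a b d) = Wt c d := fun c d => by
    simp only [hWt, hπσ]
  have hfeasσ : ∀ c (h : π c ∈ l), (ℓt ∘ Equiv.swap a b) c = y ⟨π c, h⟩ := fun c h => by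
    rw [Function.comp_apply, hfeas _ ((hπσ c).symm ▸ h)]
    simp only [hπσ]
  have hmid := hmin ((1 / 2 : ℝ) • (ℓt + ℓt ∘ Equiv.swap a b)) fun c h => by
    rw [Pi.smul_apply, Pi.add_apply, hfeas c h, hfeasσ c h, smul_eq_mul]
    ring
  rw [dotProduct_mulVec_midpoint,
    dotProduct_laplacian_add_smul_one_mulVec_comp_equiv hM γ _ hσ] at hmid
  have hzero := eq_zero_of_dotProduct_laplacian_add_smul_one_mulVec_nonpos hM hMnn hγ
    (x := (1 / 2 : ℝ) • (ℓt - ℓt ∘ Equiv.swap a b)) (by linarith)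
  have ha := congrFun hzero a
  simp only [Pi.smul_apply, Pi.sub_apply, Function.comp_apply, Equiv.swap_apply_left,
    smul_eq_mul, Pi.zero_apply] at ha
  linarith
end

section
/- (Proposition 1.) Let W be a real symmetric m×m matrix with nonnegative entries, v : Fin m → ℕ positive multiplicities with v_i = 1 for every labeled vertex, n = Σ_i v_i, π : Fin n → Fin m a surjection with fibers of size v_i, W̃ the expanded n×n matrix with W̃_{ab} = W_{π(a)π(b)}, and L̃ its graph Laplacian. Let V = diag(v), Ŵ = V·W·V, and L̂ the graph Laplacian of Ŵ. Fix γ > 0, a labeled set l ⊆ Fin m with complement u, and labels y : l → ℝ. Then the unique minimizer ℓ̃* of ℓ̃ᵀ (L̃ + γ·I) ℓ̃ subject to ℓ̃_a = y_{π(a)} for all a with π(a) ∈ l satisfies, for every a with π(a) ∈ u, ℓ̃*_a = ℓ̂_{π(a)}, where ℓ̂_u = (L̂_uu + γ·V_uu)⁻¹ · Ŵ_ul · y is the compact regularized harmonic function solution. -/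
open Matrix

/-- If a symmetric quadratic form is minimal at `x` along the `a`-th coordinate direction, then
the `a`-th partial derivative vanishes at `x`. -/
lemma mulVec_apply_eq_zero_of_forall_le {ι : Type*} [Fintype ι] [DecidableEq ι]
    {A : Matrix ι ι ℝ} (hA : A.IsSymm) {x : ι → ℝ} {a : ι}
    (h : ∀ t : ℝ, x ⬝ᵥ (A *ᵥ x) ≤
      (x + t • Pi.single a 1) ⬝ᵥ (A *ᵥ (x + t • Pi.single a 1))) :
    (A *ᵥ x) a = 0 := by
  have hcomm : x ⬝ᵥ (A *ᵥ Pi.single a 1) = (A *ᵥ x) a := by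
    rw [dotProduct_mulVec, ← mulVec_transpose, hA.eq, dotProduct_single_one]
  have hexp (t : ℝ) : 0 ≤ A a a * (t * t) + 2 * (A *ᵥ x) a * t + 0 := by
    have ht := h t
    simp only [mulVec_add, mulVec_smul, add_dotProduct, dotProduct_add, smul_dotProduct,
      dotProduct_smul, hcomm, single_one_dotProduct, smul_eq_mul] at ht
    simp only [mulVec_single_one, col_apply] at ht
    linarith
  have hdiscrim := discrim_le_zero hexp
  simp only [discrim] at hdiscrim
  nlinarith [sq_nonneg ((A *ᵥ x) a)]

/-- The coordinates of a graph Laplacian plus a diagonal matrix, applied to a vector. -/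
lemma laplacian_add_mulVec_apply {ι : Type*} [Fintype ι] [DecidableEq ι]
    (M : Matrix ι ι ℝ) (d x : ι → ℝ) (i : ι) :
    ((diagonal (fun i => ∑ j, M i j) - M + diagonal d) *ᵥ x) i =
      (∑ j, M i j + d i) * x i - ∑ j, M i j * x j := by
  simp only [add_mulVec, sub_mulVec, Pi.add_apply, Pi.sub_apply, mulVec_diagonal]
  simp only [mulVec, dotProduct]
  ring

/-- A principal submatrix of a graph Laplacian plus a positive diagonal is nonsingular. -/
lemma det_laplacian_add_submatrix_ne_zero {ι κ : Type*} [Fintype ι] [DecidableEq ι]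
    [Fintype κ] [DecidableEq κ] {M : Matrix ι ι ℝ} (hM : ∀ i j, 0 ≤ M i j)
    {d : ι → ℝ} (hd : ∀ i, 0 < d i) {e : κ → ι} (he : Function.Injective e) :
    ((diagonal (fun i => ∑ j, M i j) - M + diagonal d).submatrix e e).det ≠ 0 := by
  refine det_ne_zero_of_sum_row_lt_diag fun k => ?_
  have hle : ∑ j, M (e k) (e j) ≤ ∑ j, M (e k) j := by
    rw [← Finset.sum_image (s := Finset.univ) (f := fun j => M (e k) j) he.injOn]
    exact Finset.sum_le_sum_of_subset_of_nonneg (Finset.subset_univ _) fun j _ _ => hM _ j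
  rw [← Finset.add_sum_erase _ _ (Finset.mem_univ k)] at hle
  have hoff : ∑ j ∈ Finset.univ.erase k,
      ‖(diagonal (fun i => ∑ j, M i j) - M + diagonal d).submatrix e e k j‖ =
      ∑ j ∈ Finset.univ.erase k, M (e k) (e j) := by
    refine Finset.sum_congr rfl fun j hj => ?_
    have hne : e k ≠ e j := fun h => Finset.ne_of_mem_erase hj (he h).symm
    simp [diagonal_apply_ne _ hne, abs_of_nonneg (hM _ _)]
  rw [hoff]
  refine lt_of_lt_of_le ?_ (Real.le_norm_self _)
  simp only [submatrix_apply, Matrix.add_apply, Matrix.sub_apply, diagonal_apply_eq]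
  linarith [hd (e k)]

/-- Proposition 1: the minimizer of the regularized Laplacian quadratic form
on the expanded graph agrees, on every copy of an unlabeled vertex, with the
compact regularized harmonic function solution
`ℓ̂_u = (L̂_uu + γ V_uu)⁻¹ Ŵ_ul y` computed on the quantized graph. -/
theorem quantized_minimizer_eq_compact_harmonic_solution
    {m n : ℕ} (W : Matrix (Fin m) (Fin m) ℝ)
    (hsymm : W.IsSymm) (hnn : ∀ i j, 0 ≤ W i j)
    (l : Finset (Fin m)) (y : {i // i ∈ l} → ℝ)
    (v : Fin m → ℕ) (hv : ∀ i, 0 < v i) (hvl : ∀ i ∈ l, v i = 1)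
    (hn : n = ∑ i, v i)
    (π : Fin n → Fin m) (hπ : Function.Surjective π)
    (hfib : ∀ i, (Finset.univ.filter fun a => π a = i).card = v i)
    (Wt : Matrix (Fin n) (Fin n) ℝ)
    (hWt : ∀ a b, Wt a b = W (π a) (π b))
    (Lt : Matrix (Fin n) (Fin n) ℝ)
    (hLt : Lt = Matrix.diagonal (fun a => ∑ b, Wt a b) - Wt)
    (V : Matrix (Fin m) (Fin m) ℝ)
    (hV : V = Matrix.diagonal fun i => (v i : ℝ))
    (What : Matrix (Fin m) (Fin m) ℝ) (hWhat : What = V * W * V)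
    (Lhat : Matrix (Fin m) (Fin m) ℝ)
    (hLhat : Lhat = Matrix.diagonal (fun i => ∑ j, What i j) - What)
    (Lhatuu : Matrix {i // i ∈ lᶜ} {i // i ∈ lᶜ} ℝ)
    (hLhatuu : Lhatuu = Lhat.submatrix Subtype.val Subtype.val)
    (Vuu : Matrix {i // i ∈ lᶜ} {i // i ∈ lᶜ} ℝ)
    (hVuu : Vuu = V.submatrix Subtype.val Subtype.val)
    (Whatul : Matrix {i // i ∈ lᶜ} {i // i ∈ l} ℝ)
    (hWhatul : Whatul = What.submatrix Subtype.val Subtype.val)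
    (γ : ℝ) (hγ : 0 < γ)
    (ℓt : Fin n → ℝ)
    (hfeas : ∀ a (h : π a ∈ l), ℓt a = y ⟨π a, h⟩)
    (hmin : ∀ ℓ' : Fin n → ℝ, (∀ a (h : π a ∈ l), ℓ' a = y ⟨π a, h⟩) →
      ℓt ⬝ᵥ ((Lt + γ • 1) *ᵥ ℓt) ≤ ℓ' ⬝ᵥ ((Lt + γ • 1) *ᵥ ℓ')) :
    ∀ a (h : π a ∉ l),
      ℓt a = (((Lhatuu + γ • Vuu)⁻¹ * Whatul) *ᵥ y) ⟨π a, Finset.mem_compl.mpr h⟩ := by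
  have hsum (g : Fin m → ℝ) : ∑ b, g (π b) = ∑ j, (v j : ℝ) * g j := by
    rw [← Finset.sum_fiberwise' Finset.univ π g]
    simp [hfib]
  have hWtsymm : Wt.IsSymm := by
    ext a b
    rw [transpose_apply, hWt, hWt, hsymm.apply]
  have hAsymm : (Lt + γ • (1 : Matrix (Fin n) (Fin n) ℝ)).IsSymm := by
    rw [hLt]
    exact ((isSymm_diagonal _).sub hWtsymm).add (isSymm_one.smul γ)
  have hstat (a : Fin n) (ha : π a ∉ l) :
      (∑ b, W (π a) (π b) + γ) * ℓt a = ∑ b, W (π a) (π b) * ℓt b := by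
    have h0 := mulVec_apply_eq_zero_of_forall_le hAsymm (x := ℓt) (a := a) fun t =>
      hmin _ fun b hb => by
        have hba : b ≠ a := fun h => ha (h ▸ hb)
        simp [hba, hfeas b hb]
    rw [hLt, smul_one_eq_diagonal, laplacian_add_mulVec_apply] at h0
    simp only [hWt] at h0
    linarith
  have hconst (a b : Fin n) (hab : π a = π b) : ℓt a = ℓt b := by
    by_cases ha : π a ∈ l
    · rw [hfeas a ha, hfeas b (hab ▸ ha)]
      simp only [hab]
    · have h1 := hstat a ha
      have h2 := hstat b (hab ▸ ha)
      rw [← hab, ← h1] at h2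
      have hpos : 0 < ∑ c, W (π a) (π c) + γ :=
        add_pos_of_nonneg_of_pos (Finset.sum_nonneg fun c _ => hnn _ _) hγ
      exact (mul_left_cancel₀ hpos.ne' h2).symm
  obtain ⟨s, hs⟩ := hπ.hasRightInverse
  set f : Fin m → ℝ := fun i => ℓt (s i) with hf
  have hfπ (a : Fin n) : ℓt a = f (π a) := hconst _ _ (hs (π a)).symm
  have hfl (i : {i // i ∈ l}) : f i = y i := by
    have hi : π (s i) ∈ l := by rw [hs]; exact i.2
    rw [hf]
    simp only [hfeas _ hi, hs (i : Fin m)]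
  have hWhat_apply (i j : Fin m) : What i j = v i * (W i j * v j) := by
    rw [hWhat, hV, mul_diagonal, diagonal_mul, mul_assoc]
  have hVγ : γ • V = diagonal fun i => γ * (v i : ℝ) := by
    rw [hV, ← diagonal_smul]
    rfl
  have hharm (i : Fin m) (hi : i ∉ l) : ((Lhat + γ • V) *ᵥ f) i = 0 := by
    have h1 := hstat (s i) (by rwa [hs])
    simp only [hs i, hfπ] at h1
    rw [hsum (fun j => W i j), hsum (fun j => W i j * f j)] at h1
    rw [hLhat, hVγ, laplacian_add_mulVec_apply]
    simp only [hWhat_apply, mul_assoc, ← Finset.mul_sum]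
    have e1 : ∑ j, W i j * (v j : ℝ) = ∑ j, (v j : ℝ) * W i j :=
      Finset.sum_congr rfl fun j _ => mul_comm _ _
    have e2 : ∑ j, W i j * ((v j : ℝ) * f j) = ∑ j, (v j : ℝ) * (W i j * f j) :=
      Finset.sum_congr rfl fun j _ => by ring
    rw [e1, e2, ← h1]
    ring
  have hM : Lhatuu + γ • Vuu = (Lhat + γ • V).submatrix Subtype.val Subtype.val := by
    rw [hLhatuu, hVuu]
    rfl
  have hdet : IsUnit (Lhatuu + γ • Vuu).det := by
    rw [hM, hLhat, hVγ, isUnit_iff_ne_zero]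
    refine det_laplacian_add_submatrix_ne_zero (fun i j => ?_) (fun i => ?_)
      Subtype.val_injective
    · rw [hWhat_apply]
      exact mul_nonneg (Nat.cast_nonneg _) (mul_nonneg (hnn _ _) (Nat.cast_nonneg _))
    · exact mul_pos hγ (Nat.cast_pos.mpr (hv i))
  have hsystem : (Lhatuu + γ • Vuu) *ᵥ (fun i => f i) = Whatul *ᵥ y := by
    ext i
    have hi : (i : Fin m) ∉ l := Finset.mem_compl.mp i.2
    have h0 := hharm i hi
    simp only [mulVec, dotProduct] at h0 ⊢
    rw [← Finset.sum_add_sum_compl l, ← Finset.sum_coe_sort l, ← Finset.sum_coe_sort lᶜ] at h0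
    have hl : ∑ j : {j // j ∈ l}, (Lhat + γ • V) i j * f j =
        -∑ j, Whatul i j * y j := by
      rw [← Finset.sum_neg_distrib]
      refine Finset.sum_congr rfl fun j _ => ?_
      have hij : (i : Fin m) ≠ j := fun h => hi (h ▸ j.2)
      rw [hfl, hLhat, hVγ, hWhatul]
      simp [diagonal_apply_ne _ hij]
    rw [hl] at h0
    rw [hM]
    simp only [submatrix_apply]
    linarith
  intro a ha
  rw [← mulVec_mulVec, ← hsystem, mulVec_mulVec, nonsing_inv_mul _ hdet, one_mulVec, hfπ]
end

section
/- (Outliers receive zero prediction.) Let W be a real symmetric n×n matrix with nonnegative entries, L its graph Laplacian, l ⊆ Fin n the labeled set with complement u, y : l → ℝ, and γ > 0. Suppose an unlabeled vertex i ∈ u is disconnected from the rest of the graph, i.e., W_ij = 0 for all j ≠ i. Then the regularized harmonic function solution ℓ_u = (L_uu + γ·I)⁻¹ · W_ul · y satisfies ℓ_i = 0; i.e., the method expresses no preference for the label of a disconnected (outlier) vertex. -/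
open Matrix

/-- If the only nonzero entry of row `i` of `A` is the diagonal one, then `A⁻¹ *ᵥ b` vanishes at `i`
whenever `b` does. -/
theorem inv_mulVec_apply_eq_zero_of_row_diagonal {m K : Type*} [Fintype m] [DecidableEq m] [Field K]
    {A : Matrix m m K} {b : m → K} {i : m} (hdiag : A i i ≠ 0) (hoff : ∀ j, j ≠ i → A i j = 0)
    (hb : b i = 0) : (A⁻¹ *ᵥ b) i = 0 := by
  by_cases hA : IsUnit A.det
  · have h : (A *ᵥ (A⁻¹ *ᵥ b)) i = b i := by
      rw [mulVec_mulVec, mul_nonsing_inv A hA, one_mulVec]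
    rw [mulVec_eq_sum, Finset.sum_apply, Finset.sum_eq_single i
      (fun j _ hj => by simp [hoff j hj]) (by simp), hb] at h
    simpa [hdiag] using h
  · simp [nonsing_inv_apply_not_isUnit A hA]

/-- Outliers receive zero prediction: the regularized harmonic function
solution vanishes at any unlabeled vertex that is disconnected from the rest
of the graph. -/
theorem regularized_harmonic_solution_zero_on_outliers
    {n : ℕ} (W : Matrix (Fin n) (Fin n) ℝ)
    (hsymm : W.IsSymm) (hnn : ∀ i j, 0 ≤ W i j)
    (l : Finset (Fin n)) (y : {i // i ∈ l} → ℝ)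
    (γ : ℝ) (hγ : 0 < γ)
    (L : Matrix (Fin n) (Fin n) ℝ)
    (hL : L = Matrix.diagonal (fun i => ∑ j, W i j) - W)
    (Luu : Matrix {i // i ∈ lᶜ} {i // i ∈ lᶜ} ℝ)
    (hLuu : Luu = L.submatrix Subtype.val Subtype.val)
    (Wul : Matrix {i // i ∈ lᶜ} {i // i ∈ l} ℝ)
    (hWul : Wul = W.submatrix Subtype.val Subtype.val)
    (i : Fin n) (hi : i ∉ l) (hout : ∀ j, j ≠ i → W i j = 0) :
    (((Luu + γ • 1)⁻¹ * Wul) *ᵥ y) ⟨i, Finset.mem_compl.mpr hi⟩ = 0 := by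
  subst hL hLuu hWul
  have hsum : ∑ j, W i j = W i i :=
    Finset.sum_eq_single i (fun j _ hj => hout j hj) (by simp)
  rw [← mulVec_mulVec]
  refine inv_mulVec_apply_eq_zero_of_row_diagonal ?_ (fun j hj => ?_) ?_
  · simp [hsum, hγ.ne']
  · have hne : (j : Fin n) ≠ i := fun h => hj (Subtype.ext h)
    simp [diagonal_apply_ne' _ hne, one_apply_ne' hj, hout j hne]
  · refine Finset.sum_eq_zero fun j _ => ?_
    have hne : (j : Fin n) ≠ i := fun h => hi (h ▸ j.2)
    simp [hout j hne]
end
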